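/- Let d ≥ 1 and let a = (a_{αγ}), b = (b_{αβ}), c = (c_{βδ}) be d×d complex matrices with b invertible. Set Z := (1/2)·a_{αγ}θ^αθ^γ + b_{αβ}θ^αθ̄^β + (1/2)·c_{βδ}θ̄^βθ̄^δ ∈ Λ_d (summation over repeated indices) and write e^Z = w_{IJ}θ^Iθ̄^J with w_{IJ} ∈ ℂ. Then the 2^d×2^d complex matrix (w_{IJ}), with rows indexed by subsets I ⊆ [d] and columns by subsets J ⊆ [d], is invertible. -/

import Mathlib

noncomputable section
open scoped BigOperators

namespace Grass

/-- Index sets for Grassmann monomials: subsets of `[d] = {1,…,d}` (0-based in Lean). -/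
abbrev Ix (d : ℕ) := Finset (Fin d)

/-- Coefficient representation of the Grassmann algebra `Λ_d` on the `2d` generators
`θ^1,…,θ^d, θ̄^1,…,θ̄^d`: an element is the family of its coefficients in the
basis `θ^I θ̄^J`, `I, J ⊆ [d]`. -/
abbrev Gr (d : ℕ) := Ix d → Ix d → ℂ

/-- The sign `(±1)` obtained when reordering `θ^I · θ^K` (with `I, K` disjoint) into the
increasing monomial `θ^{I ∪ K}`: one transposition for each pair `i ∈ I, k ∈ K` with `k < i`. -/
def rsign {d : ℕ} (I K : Ix d) : ℤ := (-1 : ℤ) ^ (∑ i ∈ I, (K.filter (fun k => k < i)).card)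

/-- The (associative) multiplication of the Grassmann algebra `Λ_d` in the coefficient
representation: determined by `θ^I θ̄^J · θ^K θ̄^L = (-1)^{|J||K|} rsign(I,K) rsign(J,L)
θ^{I∪K} θ̄^{J∪L}` for disjoint `I,K` and disjoint `J,L`, and `0` otherwise. -/
def gmul {d : ℕ} (f g : Gr d) : Gr d := fun K L =>
  ∑ I ∈ K.powerset, ∑ J ∈ L.powerset,
    (((-1 : ℤ) ^ (J.card * (K \ I).card) * rsign I (K \ I) * rsign J (L \ J) : ℤ) : ℂ) *
      (f I J * g (K \ I) (L \ J))

/-- The identity `1 = θ^∅ θ̄^∅` of `Λ_d`. -/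
def gone (d : ℕ) : Gr d := fun K L => if K = ∅ ∧ L = ∅ then 1 else 0

/-- Powers in `Λ_d`. -/
def gpow {d : ℕ} (f : Gr d) : ℕ → Gr d
  | 0 => gone d
  | n + 1 => gmul (gpow f n) f

/-- The exponential `e^f = Σ_{n≥0} f^n/n!` of a nilpotent element of `Λ_d`
(all powers `f^n` with `n > 2d` of an element with no `θ^∅θ̄^∅`-component vanish,
so the series is the indicated finite sum). -/
def gexp {d : ℕ} (f : Gr d) : Gr d :=
  ∑ n ∈ Finset.range (2 * d + 1), ((n.factorial : ℂ)⁻¹) • gpow f n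

/-- The generator `θ^α`. -/
def θ {d : ℕ} (α : Fin d) : Gr d := fun K L => if K = {α} ∧ L = ∅ then 1 else 0

/-- The generator `θ̄^β`. -/
def θb {d : ℕ} (β : Fin d) : Gr d := fun K L => if K = ∅ ∧ L = {β} then 1 else 0

/-- The monomial `θ^I`. -/
def θmon {d : ℕ} (I : Ix d) : Gr d := fun K L => if K = I ∧ L = ∅ then 1 else 0

/-- The quadratic element
`Z = (1/2)a_{αγ}θ^αθ^γ + b_{αβ}θ^αθ̄^β + (1/2)c_{βδ}θ̄^βθ̄^δ` of `Λ_d`. -/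
def quadZ {d : ℕ} (a b c : Matrix (Fin d) (Fin d) ℂ) : Gr d :=
  (1 / 2 : ℂ) • (∑ α, ∑ γ, a α γ • gmul (θ α) (θ γ))
    + (∑ α, ∑ β, b α β • gmul (θ α) (θb β))
    + (1 / 2 : ℂ) • (∑ β, ∑ δ, c β δ • gmul (θb β) (θb δ))

/-- `ε(I) = α_1 + ⋯ + α_k − k(k+1)/2` for `I = {α_1 < … < α_k} ⊆ [d]`
(`1`-based values, so `α+1` for `α : Fin d`). -/
def epsZ {d : ℕ} (I : Ix d) : ℤ :=
  (∑ α ∈ I, ((α : ℤ) + 1)) - (I.card * (I.card + 1)) / 2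


/-- Sign of moving `β` to its place from the right of `L`. -/
def sg {d : ℕ} (L : Ix d) (β : Fin d) : ℂ := (-1 : ℂ) ^ (L.filter (fun k => β < k)).card

lemma sg_sq {d : ℕ} (L : Ix d) (β : Fin d) : sg L β * sg L β = 1 := by
  unfold sg
  rw [← mul_pow]; simp

lemma sg_ne {d : ℕ} (L : Ix d) (β : Fin d) : sg L β ≠ 0 := by
  intro h
  have := sg_sq L β
  rw [h] at this
  simp at this

lemma sg_insert {d : ℕ} (L : Ix d) (β δ : Fin d) (h : δ ∉ L) :
    sg (insert δ L) β = (if β < δ then -1 else 1) * sg L β := by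
  unfold sg
  rw [Finset.filter_insert]
  split_ifs with h1
  · rw [Finset.card_insert_of_notMem (by simp [h]), pow_succ]; ring
  · simp

lemma sg_erase {d : ℕ} (L : Ix d) (β δ : Fin d) (h : δ ∈ L) :
    sg (L.erase δ) β = (if β < δ then -1 else 1) * sg L β := by
  have := sg_insert (L.erase δ) β δ (by simp)
  rw [Finset.insert_erase h] at this
  rw [this]
  split_ifs <;> ring

/-- Right multiplication by `θ^α`. -/
def opX {d : ℕ} (α : Fin d) : Module.End ℂ (Gr d) where
  toFun f := fun K L => if α ∈ K then (-1 : ℂ) ^ L.card * sg K α * f (K.erase α) L else 0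
  map_add' f g := by
    funext K L
    simp only [Pi.add_apply]
    split_ifs <;> ring
  map_smul' r f := by
    funext K L
    simp only [Pi.smul_apply, smul_eq_mul, RingHom.id_apply]
    split_ifs <;> ring

/-- Right multiplication by `θ̄^β`. -/
def opY {d : ℕ} (β : Fin d) : Module.End ℂ (Gr d) where
  toFun f := fun K L => if β ∈ L then sg L β * f K (L.erase β) else 0
  map_add' f g := by
    funext K L
    simp only [Pi.add_apply]
    split_ifs <;> ring
  map_smul' r f := by
    funext K L
    simp only [Pi.smul_apply, smul_eq_mul, RingHom.id_apply]
    split_ifs <;> ring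

/-- Right derivative by `θ̄^β`. -/
def opD {d : ℕ} (β : Fin d) : Module.End ℂ (Gr d) where
  toFun f := fun K L => if β ∈ L then 0 else sg L β * f K (insert β L)
  map_add' f g := by
    funext K L
    simp only [Pi.add_apply]
    split_ifs <;> ring
  map_smul' r f := by
    funext K L
    simp only [Pi.smul_apply, smul_eq_mul, RingHom.id_apply]
    split_ifs <;> ring

lemma opX_apply {d : ℕ} (α : Fin d) (f : Gr d) (K L : Ix d) : opX α f K L =
  if α ∈ K then (-1 : ℂ) ^ L.card * sg K α * f (K.erase α) L else 0 := rfl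
lemma opY_apply {d : ℕ} (β : Fin d) (f : Gr d) (K L : Ix d) : opY β f K L =
  if β ∈ L then sg L β * f K (L.erase β) else 0 := rfl
lemma opD_apply {d : ℕ} (β : Fin d) (f : Gr d) (K L : Ix d) : opD β f K L =
  if β ∈ L then 0 else sg L β * f K (insert β L) := rfl

lemma XX {d : ℕ} (α γ : Fin d) : opX α * opX γ = -(opX γ * opX α) := by
  refine LinearMap.ext fun f => funext fun K => funext fun L => ?_
  simp only [Module.End.mul_apply, LinearMap.neg_apply, Pi.neg_apply, opX_apply, Finset.mem_erase]
  rcases eq_or_ne α γ with rfl | h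
  · simp
  · by_cases h1 : α ∈ K <;> by_cases h2 : γ ∈ K <;> simp only [h1, h2, h, h.symm, ne_eq, not_false_eq_true, and_true, true_and, and_false, and_self, if_true, if_false, mul_zero, neg_zero]
    rw [sg_erase _ _ _ h1, sg_erase _ _ _ h2, Finset.erase_right_comm]
    rcases lt_or_gt_of_ne h with h3 | h3
    · rw [if_pos h3, if_neg h3.not_gt]; ring
    · rw [if_pos h3, if_neg h3.not_gt]; ring

lemma YY {d : ℕ} (α γ : Fin d) : opY α * opY γ = -(opY γ * opY α) := by
  refine LinearMap.ext fun f => funext fun L => funext fun K => ?_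
  simp only [Module.End.mul_apply, LinearMap.neg_apply, Pi.neg_apply, opY_apply, Finset.mem_erase]
  rcases eq_or_ne α γ with rfl | h
  · simp
  · by_cases h1 : α ∈ K <;> by_cases h2 : γ ∈ K <;> simp only [h1, h2, h, h.symm, ne_eq, not_false_eq_true, and_true, true_and, and_false, and_self, if_true, if_false, mul_zero, neg_zero]
    rw [sg_erase _ _ _ h1, sg_erase _ _ _ h2, Finset.erase_right_comm]
    rcases lt_or_gt_of_ne h with h3 | h3
    · rw [if_pos h3, if_neg h3.not_gt]; ring
    · rw [if_pos h3, if_neg h3.not_gt]; ring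

lemma XY {d : ℕ} (α β : Fin d) : opX α * opY β = -(opY β * opX α) := by
  refine LinearMap.ext fun f => funext fun K => funext fun L => ?_
  simp only [Module.End.mul_apply, LinearMap.neg_apply, Pi.neg_apply, opX_apply, opY_apply]
  by_cases h1 : α ∈ K <;> by_cases h2 : β ∈ L <;> simp only [h1, h2, if_true, if_false, mul_zero, neg_zero]
  rw [← Finset.card_erase_add_one h2, pow_succ]
  ring

lemma DX {d : ℕ} (α β : Fin d) : opD β * opX α = -(opX α * opD β) := by
  refine LinearMap.ext fun f => funext fun K => funext fun L => ?_
  simp only [Module.End.mul_apply, LinearMap.neg_apply, Pi.neg_apply, opX_apply, opD_apply]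
  by_cases h1 : α ∈ K <;> by_cases h2 : β ∈ L <;> simp only [h1, h2, if_true, if_false, mul_zero, neg_zero]
  rw [Finset.card_insert_of_notMem h2, pow_succ]
  ring

lemma DY {d : ℕ} (β δ : Fin d) : opD β * opY δ = (if β = δ then (1 : ℂ) else 0) • (1 : Module.End ℂ (Gr d)) - opY δ * opD β := by
  refine LinearMap.ext fun f => funext fun K => funext fun L => ?_
  simp only [Module.End.mul_apply, LinearMap.sub_apply, LinearMap.smul_apply, Module.End.one_apply, Pi.smul_apply, smul_eq_mul, Pi.sub_apply, opY_apply, opD_apply, Finset.mem_erase, Finset.mem_insert]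
  rcases eq_or_ne β δ with rfl | h
  · by_cases h2 : β ∈ L
    · simp only [h2, if_true, ne_eq, not_true_eq_false, false_and, if_false, Finset.insert_erase h2, sg_erase _ _ _ h2, lt_irrefl]
      linear_combination (f K L) * sg_sq L β
    · simp only [h2, if_true, if_false, true_or, Finset.erase_insert h2, sg_insert _ _ _ h2, lt_irrefl]
      linear_combination (f K L) * sg_sq L β
  · by_cases h1 : β ∈ L <;> by_cases h2 : δ ∈ L <;> simp only [h1, h2, h, h.symm, ne_eq, not_false_eq_true, and_true, true_and, and_false, or_true, or_false, if_true, if_false, mul_zero, zero_mul, sub_zero]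
    rw [sg_insert _ _ _ h1, sg_erase _ _ _ h2, Finset.erase_insert_of_ne h]
    rcases lt_or_gt_of_ne h with h3 | h3
    · rw [if_pos h3, if_neg h3.not_gt]; ring
    · rw [if_pos h3, if_neg h3.not_gt]; ring

lemma rsign_insert {d : ℕ} (I M : Ix d) (γ : Fin d) (h : γ ∉ M) :
    ((rsign I (insert γ M) : ℤ) : ℂ) = sg I γ * ((rsign I M : ℤ) : ℂ) := by
  unfold rsign sg
  push_cast
  rw [← pow_add]
  congr 1
  rw [Finset.card_filter, ← Finset.sum_add_distrib]
  refine Finset.sum_congr rfl fun i _ => ?_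
  rw [Finset.filter_insert]
  split_ifs with h1
  · rw [Finset.card_insert_of_notMem (by simp [h])]; ring
  · simp

lemma sg_union {d : ℕ} (I K : Ix d) (γ : Fin d) (h : I ⊆ K) :
    sg K γ = sg I γ * sg (K \ I) γ := by
  unfold sg
  rw [← pow_add]
  congr 1
  conv_lhs => rw [← Finset.union_sdiff_of_subset h]
  rw [Finset.filter_union, Finset.card_union_of_disjoint]
  exact Finset.disjoint_filter_filter Finset.disjoint_sdiff

lemma gmul_Y {d : ℕ} (f g : Gr d) (β : Fin d) : gmul f (opY β g) = opY β (gmul f g) := by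
  funext K L
  rw [opY_apply]
  unfold gmul
  split_ifs with hL
  · rw [Finset.mul_sum]
    refine Finset.sum_congr rfl fun I hI => ?_
    rw [Finset.mul_sum]
    symm
    apply Finset.sum_subset_zero_on_sdiff
    · exact Finset.powerset_mono.2 (Finset.erase_subset _ _)
    · intro J hJ
      simp only [Finset.mem_sdiff, Finset.mem_powerset, Finset.subset_erase, not_and, not_not] at hJ
      rw [opY_apply, if_neg (by simp [hJ.2 hJ.1])]
      simp
    · intro J hJ
      simp only [Finset.mem_powerset, Finset.subset_erase] at hJ
      have hm : β ∈ L \ J := by simp [hL, hJ.2]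
      have e : L.erase β \ J = (L \ J).erase β := by ext; simp; tauto
      rw [opY_apply, if_pos hm, e]
      have h1 := rsign_insert J ((L \ J).erase β) β (by simp)
      rw [Finset.insert_erase hm] at h1
      push_cast
      rw [h1, sg_union J L β hJ.1]
      ring
  · refine Finset.sum_eq_zero fun I _ => Finset.sum_eq_zero fun J _ => ?_
    rw [opY_apply, if_neg (by simp [hL])]
    simp

lemma gmul_X {d : ℕ} (f g : Gr d) (α : Fin d) : gmul f (opX α g) = opX α (gmul f g) := by
  funext K L
  rw [opX_apply]
  unfold gmul
  split_ifs with hK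
  · rw [Finset.mul_sum]
    symm
    apply Finset.sum_subset_zero_on_sdiff
    · exact Finset.powerset_mono.2 (Finset.erase_subset _ _)
    · intro I hI
      simp only [Finset.mem_sdiff, Finset.mem_powerset, Finset.subset_erase, not_and, not_not] at hI
      refine Finset.sum_eq_zero fun J _ => ?_
      rw [opX_apply, if_neg (by simp [hI.2 hI.1])]
      simp
    · intro I hI
      rw [Finset.mul_sum]
      refine Finset.sum_congr rfl fun J hJ => ?_
      simp only [Finset.mem_powerset, Finset.subset_erase] at hI hJ
      have hm : α ∈ K \ I := by simp [hK, hI.2]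
      have e : K.erase α \ I = (K \ I).erase α := by ext; simp; tauto
      rw [opX_apply, if_pos hm, e]
      have h1 := rsign_insert I ((K \ I).erase α) α (by simp)
      rw [Finset.insert_erase hm] at h1
      push_cast
      rw [h1, sg_union I K α hI.1, ← Finset.card_erase_add_one hm,
        ← Finset.card_sdiff_add_card_eq_card hJ, mul_add, pow_add, pow_add, mul_one]
      ring
  · refine Finset.sum_eq_zero fun I _ => Finset.sum_eq_zero fun J _ => ?_
    rw [opX_apply, if_neg (by simp [hK])]
    simp

lemma gmul_one {d : ℕ} (f : Gr d) : gmul f (gone d) = f := by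
  funext K L
  unfold gmul gone
  rw [Finset.sum_eq_single K, Finset.sum_eq_single L]
  · simp [rsign]
  · intro J hJ hne
    rw [if_neg]
    · simp
    · rintro ⟨-, h⟩
      exact hne (Finset.Subset.antisymm (Finset.mem_powerset.1 hJ) (Finset.sdiff_eq_empty_iff_subset.1 h))
  · simp
  · intro J hJ hne
    refine Finset.sum_eq_zero fun _ _ => ?_
    rw [if_neg]
    · simp
    · rintro ⟨h, -⟩
      exact hne (Finset.Subset.antisymm (Finset.mem_powerset.1 hJ) (Finset.sdiff_eq_empty_iff_subset.1 h))
  · simp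

lemma theta_eq {d : ℕ} (α : Fin d) : θ α = opX α (gone d) := by
  funext K L
  rw [opX_apply]
  unfold θ gone
  by_cases hL : L = ∅
  · subst hL
    by_cases hK : K = {α}
    · subst hK; simp [sg, Finset.filter_singleton]
    · by_cases h : α ∈ K
      · have : K.erase α ≠ ∅ := by
          intro h2
          apply hK
          rw [← Finset.insert_erase h, h2]; simp
        simp [hK, h, this]
      · simp [hK, h]
  · simp [hL]

lemma thetab_eq {d : ℕ} (α : Fin d) : θb α = opY α (gone d) := by
  funext L K
  rw [opY_apply]
  unfold θb gone
  by_cases hL : L = ∅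
  · subst hL
    by_cases hK : K = {α}
    · subst hK; simp [sg, Finset.filter_singleton]
    · by_cases h : α ∈ K
      · have : K.erase α ≠ ∅ := by
          intro h2
          apply hK
          rw [← Finset.insert_erase h, h2]; simp
        simp [hK, h, this]
      · simp [hK, h]
  · simp [hL]

/-- `gmul f` as a linear map. -/
def gmulL {d : ℕ} (f : Gr d) : Module.End ℂ (Gr d) where
  toFun g := gmul f g
  map_add' g h := by
    funext K L
    simp only [gmul, Pi.add_apply, ← Finset.sum_add_distrib, mul_add]
  map_smul' r g := by
    funext K L
    simp only [gmul, Pi.smul_apply, smul_eq_mul, RingHom.id_apply, Finset.mul_sum]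
    refine Finset.sum_congr rfl fun I _ => Finset.sum_congr rfl fun J _ => ?_
    ring

/-- Right multiplication by `Z`. -/
def opR {d : ℕ} (a b c : Matrix (Fin d) (Fin d) ℂ) : Module.End ℂ (Gr d) :=
  (1 / 2 : ℂ) • (∑ α, ∑ γ, a α γ • (opX γ * opX α))
    + (∑ α, ∑ β, b α β • (opY β * opX α))
    + (1 / 2 : ℂ) • (∑ β, ∑ δ, c β δ • (opY δ * opY β))

lemma gmul_quadZ {d : ℕ} (a b c : Matrix (Fin d) (Fin d) ℂ) (f : Gr d) :
    gmul f (quadZ a b c) = opR a b c f := by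
  change gmulL f (quadZ a b c) = _
  unfold quadZ opR
  have h (g : Gr d) : gmulL f g = gmul f g := rfl
  simp only [map_add, map_smul, map_sum]
  simp only [LinearMap.add_apply, LinearMap.smul_apply, LinearMap.sum_apply, h, Module.End.mul_apply, theta_eq, thetab_eq, gmul_X, gmul_Y, gmul_one]

lemma gpow_eq {d : ℕ} (a b c : Matrix (Fin d) (Fin d) ℂ) (n : ℕ) :
    gpow (quadZ a b c) n = (opR a b c ^ n) (gone d) := by
  induction n with
  | zero => rfl
  | succ n ih =>
    rw [pow_succ', Module.End.mul_apply, ← ih, ← gmul_quadZ]; rfl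

/-- Commutator of `opD β` with `opR`. -/
def opS {d : ℕ} (b c : Matrix (Fin d) (Fin d) ℂ) (β : Fin d) : Module.End ℂ (Gr d) :=
  (∑ α, b α β • opX α) + (1 / 2 : ℂ) • (∑ δ, (c δ β - c β δ) • opY δ)

lemma comm_pair {A : Type*} [Ring A] {x y z : A} (h1 : z * x = -(x * z)) (h2 : z * y = -(y * z)) :
    Commute z (x * y) := by
  show z * (x * y) = x * y * z
  rw [← mul_assoc, h1, neg_mul, mul_assoc, h2, mul_neg, neg_neg, mul_assoc]

lemma YX {d : ℕ} (α β : Fin d) : opY β * opX α = -(opX α * opY β) := by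
  rw [XY, neg_neg]

lemma commX {d : ℕ} (a b c : Matrix (Fin d) (Fin d) ℂ) (α : Fin d) :
    Commute (opX α) (opR a b c) := by
  unfold opR
  refine Commute.add_right (Commute.add_right ?_ ?_) ?_
  · exact Commute.smul_right (Commute.sum_right _ _ _ fun i _ => Commute.sum_right _ _ _ fun j _ => Commute.smul_right (comm_pair (XX _ _) (XX _ _)) _) _
  · exact (Commute.sum_right _ _ _ fun i _ => Commute.sum_right _ _ _ fun j _ => Commute.smul_right (comm_pair (XY _ _) (XX _ _)) _)
  · exact Commute.smul_right (Commute.sum_right _ _ _ fun i _ => Commute.sum_right _ _ _ fun j _ => Commute.smul_right (comm_pair (XY _ _) (XY _ _)) _) _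

lemma commY {d : ℕ} (a b c : Matrix (Fin d) (Fin d) ℂ) (α : Fin d) :
    Commute (opY α) (opR a b c) := by
  unfold opR
  refine Commute.add_right (Commute.add_right ?_ ?_) ?_
  · exact Commute.smul_right (Commute.sum_right _ _ _ fun i _ => Commute.sum_right _ _ _ fun j _ => Commute.smul_right (comm_pair (YX _ _) (YX _ _)) _) _
  · exact (Commute.sum_right _ _ _ fun i _ => Commute.sum_right _ _ _ fun j _ => Commute.smul_right (comm_pair (YY _ _) (YX _ _)) _)
  · exact Commute.smul_right (Commute.sum_right _ _ _ fun i _ => Commute.sum_right _ _ _ fun j _ => Commute.smul_right (comm_pair (YY _ _) (YY _ _)) _) _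

lemma commS {d : ℕ} (a b c : Matrix (Fin d) (Fin d) ℂ) (β : Fin d) :
    Commute (opS b c β) (opR a b c) := by
  unfold opS
  refine Commute.add_left ?_ ?_
  · exact Commute.sum_left _ _ _ fun i _ => Commute.smul_left (commX _ _ _ _) _
  · exact Commute.smul_left (Commute.sum_left _ _ _ fun i _ => Commute.smul_left (commY _ _ _ _) _) _

lemma comm_aux1 {A : Type*} [Ring A] [Algebra ℂ A] {D X Y : A} {s : ℂ}
    (h1 : D * Y = s • (1 : A) - Y * D) (h2 : D * X = -(X * D)) :
    D * (Y * X) - (Y * X) * D = s • X := by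
  rw [← mul_assoc, h1, sub_mul, smul_mul_assoc, one_mul, mul_assoc, h2, mul_neg, mul_assoc]
  abel

lemma D_YX {d : ℕ} (β δ α : Fin d) : opD β * (opY δ * opX α) - (opY δ * opX α) * opD β
    = (if β = δ then (1 : ℂ) else 0) • opX α := by
  exact comm_aux1 (DY _ _) (DX _ _)

lemma D_YY {d : ℕ} (β δ ε : Fin d) : opD β * (opY δ * opY ε) - (opY δ * opY ε) * opD β
    = (if β = δ then (1 : ℂ) else 0) • opY ε - (if β = ε then (1 : ℂ) else 0) • opY δ := by
  rw [← mul_assoc, DY, sub_mul, smul_mul_assoc, one_mul, mul_assoc, DY, mul_sub, mul_smul_comm, mul_one, mul_assoc]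
  abel

lemma commD {d : ℕ} (a b c : Matrix (Fin d) (Fin d) ℂ) (β : Fin d) :
    opD β * opR a b c = opR a b c * opD β + opS b c β := by
  rw [← sub_eq_iff_eq_add']
  have e1 (α γ : Fin d) : opD β * (opX γ * opX α) - (opX γ * opX α) * opD β = 0 := by
    rw [sub_eq_zero]; exact comm_pair (DX _ _) (DX _ _)
  have : opD β * opR a b c - opR a b c * opD β =
      (1 / 2 : ℂ) • (∑ α, ∑ γ, a α γ • (opD β * (opX γ * opX α) - (opX γ * opX α) * opD β))
    + (∑ α, ∑ δ, b α δ • (opD β * (opY δ * opX α) - (opY δ * opX α) * opD β))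
    + (1 / 2 : ℂ) • (∑ ε, ∑ δ, c ε δ • (opD β * (opY δ * opY ε) - (opY δ * opY ε) * opD β)) := by
    unfold opR
    simp only [mul_add, add_mul, mul_smul_comm, smul_mul_assoc, Finset.mul_sum, Finset.sum_mul,
      smul_sub, Finset.sum_sub_distrib]
    abel
  rw [this]
  simp only [e1, D_YX, D_YY, smul_zero, Finset.sum_const_zero, zero_add]
  unfold opS
  congr 1
  · refine Finset.sum_congr rfl fun α _ => ?_
    simp
  · congr 1
    simp only [smul_sub, sub_smul, Finset.sum_sub_distrib, ite_smul, one_smul, zero_smul, smul_ite, smul_zero]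
    simp only [Finset.sum_ite_eq, Finset.mem_univ, if_true, Finset.sum_ite_irrel, Finset.sum_const_zero]
    rw [← Finset.sum_sub_distrib]
    exact Finset.sum_congr rfl fun δ _ => (sub_smul _ _ _).symm

lemma D_pow {d : ℕ} (a b c : Matrix (Fin d) (Fin d) ℂ) (β : Fin d) (n : ℕ) :
    opD β * opR a b c ^ (n + 1) = opR a b c ^ (n + 1) * opD β + ((n : ℂ) + 1) • (opS b c β * opR a b c ^ n) := by
  induction n with
  | zero => simp [commD]
  | succ n ih =>
    rw [pow_succ (opR a b c) (n + 1), ← mul_assoc, ih, add_mul, mul_assoc, commD, mul_add, smul_mul_assoc, mul_assoc (opS b c β), ← pow_succ, ← mul_assoc,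
      ← ((commS a b c β).pow_right (n + 1)).eq]
    push_cast
    module

lemma D_one {d : ℕ} (β : Fin d) : opD β (gone d) = 0 := by
  funext K L
  rw [opD_apply]
  simp [gone]

/-- Elements of degree at least `n`. -/
def degGE (d n : ℕ) : Submodule ℂ (Gr d) where
  carrier := {f | ∀ K L : Ix d, K.card + L.card < n → f K L = 0}
  add_mem' := by
    intro f g hf hg K L h
    simp [hf K L h, hg K L h]
  zero_mem' := by
    intro K L h
    rfl
  smul_mem' := by
    intro r f hf K L h
    simp [hf K L h]

lemma degX {d n : ℕ} (α : Fin d) (f : Gr d) (hf : f ∈ degGE d n) : opX α f ∈ degGE d (n + 1) := by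
  intro K L h
  rw [opX_apply]
  split_ifs with h1
  · have := Finset.card_erase_add_one h1
    rw [hf _ _ (by omega), mul_zero]
  · rfl

lemma degY {d n : ℕ} (α : Fin d) (f : Gr d) (hf : f ∈ degGE d n) : opY α f ∈ degGE d (n + 1) := by
  intro K L h
  rw [opY_apply]
  split_ifs with h1
  · have := Finset.card_erase_add_one h1
    rw [hf _ _ (by omega), mul_zero]
  · rfl

lemma degR {d n : ℕ} (a b c : Matrix (Fin d) (Fin d) ℂ) (f : Gr d) (hf : f ∈ degGE d n) :
    opR a b c f ∈ degGE d (n + 2) := by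
  unfold opR
  simp only [LinearMap.add_apply, LinearMap.smul_apply, LinearMap.sum_apply, Module.End.mul_apply]
  refine add_mem (add_mem ?_ ?_) ?_
  · exact Submodule.smul_mem _ _ (Submodule.sum_mem _ fun i _ => Submodule.sum_mem _ fun j _ => Submodule.smul_mem _ _ (degX _ _ (degX _ _ hf)))
  · exact (Submodule.sum_mem _ fun i _ => Submodule.sum_mem _ fun j _ => Submodule.smul_mem _ _ (degY _ _ (degX _ _ hf)))
  · exact Submodule.smul_mem _ _ (Submodule.sum_mem _ fun i _ => Submodule.sum_mem _ fun j _ => Submodule.smul_mem _ _ (degY _ _ (degY _ _ hf)))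

lemma degPow {d : ℕ} (a b c : Matrix (Fin d) (Fin d) ℂ) (n : ℕ) :
    (opR a b c ^ n) (gone d) ∈ degGE d (2 * n) := by
  induction n with
  | zero => intro K L h; omega
  | succ n ih =>
    rw [pow_succ', Module.End.mul_apply]
    exact degR a b c _ ih

lemma gexp_eq {d : ℕ} (a b c : Matrix (Fin d) (Fin d) ℂ) : gexp (quadZ a b c) =
    ∑ n ∈ Finset.range (2 * d + 1), ((n.factorial : ℂ)⁻¹) • (opR a b c ^ n) (gone d) := by
  unfold gexp
  simp only [gpow_eq]

lemma pow_top {d : ℕ} (hd : 1 ≤ d) (a b c : Matrix (Fin d) (Fin d) ℂ) :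
    (opR a b c ^ (2 * d)) (gone d) = 0 := by
  funext K L
  apply degPow a b c (2 * d) K L
  have h1 := Finset.card_le_univ K
  have h2 := Finset.card_le_univ L
  simp at h1 h2
  omega

lemma D_exp {d : ℕ} (hd : 1 ≤ d) (a b c : Matrix (Fin d) (Fin d) ℂ) (β : Fin d) :
    opD β (gexp (quadZ a b c)) = opS b c β (gexp (quadZ a b c)) := by
  rw [gexp_eq]
  conv_rhs => rw [Finset.sum_range_succ, pow_top hd, smul_zero, add_zero]
  rw [Finset.sum_range_succ', map_add, map_sum, map_sum, map_smul]
  simp only [pow_zero, Module.End.one_apply, D_one, smul_zero, add_zero]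
  refine Finset.sum_congr rfl fun n _ => ?_
  rw [map_smul, map_smul, ← Module.End.mul_apply, D_pow]
  simp only [LinearMap.add_apply, Module.End.mul_apply, D_one, map_zero, zero_add, LinearMap.smul_apply, smul_smul]
  congr 1
  have h1 : (n.factorial : ℂ) ≠ 0 := by exact_mod_cast n.factorial_ne_zero
  have h2 : (n : ℂ) + 1 ≠ 0 := by exact_mod_cast n.succ_ne_zero
  rw [Nat.factorial_succ]
  push_cast
  field_simp

lemma exp_zero {d : ℕ} (a b c : Matrix (Fin d) (Fin d) ℂ) :
    gexp (quadZ a b c) ∅ ∅ = 1 := by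
  rw [gexp_eq, Finset.sum_range_succ', Pi.add_apply, Pi.add_apply, Finset.sum_apply, Finset.sum_apply, Finset.sum_eq_zero]
  · simp [gone]
  · intro n _
    rw [Pi.smul_apply, Pi.smul_apply, degPow a b c (n + 1) ∅ ∅ (by simp), smul_zero]

/-- Pairing of the row index with a vector. -/
def pair {d : ℕ} (v : Ix d → ℂ) : Gr d →ₗ[ℂ] (Ix d → ℂ) where
  toFun f := fun L => ∑ K, v K * f K L
  map_add' f g := by
    funext L
    simp [mul_add, Finset.sum_add_distrib]
  map_smul' r f := by
    funext L
    simp only [Pi.smul_apply, smul_eq_mul, RingHom.id_apply, Finset.mul_sum]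
    exact Finset.sum_congr rfl fun I _ => by ring

lemma pair_apply {d : ℕ} (v : Ix d → ℂ) (f : Gr d) (L : Ix d) : pair v f L = ∑ K, v K * f K L := rfl

lemma pair_Y {d : ℕ} (v : Ix d → ℂ) (f : Gr d) (β : Fin d) (h : pair v f = 0) :
    pair v (opY β f) = 0 := by
  funext L
  rw [pair_apply]
  simp only [opY_apply]
  split_ifs
  · have := congrFun h (L.erase β)
    rw [pair_apply] at this
    have h2 := congrArg (sg L β * ·) this
    simp only [Finset.mul_sum, Pi.zero_apply, mul_zero] at h2
    rw [Pi.zero_apply, ← h2]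
    exact Finset.sum_congr rfl fun I _ => by ring
  · simp

lemma pair_D {d : ℕ} (v : Ix d → ℂ) (f : Gr d) (β : Fin d) (h : pair v f = 0) :
    pair v (opD β f) = 0 := by
  funext L
  rw [pair_apply]
  simp only [opD_apply]
  split_ifs
  · simp
  · have := congrFun h (insert β L)
    rw [pair_apply] at this
    have h2 := congrArg (sg L β * ·) this
    simp only [Finset.mul_sum, Pi.zero_apply, mul_zero] at h2
    rw [Pi.zero_apply, ← h2]
    exact Finset.sum_congr rfl fun I _ => by ring

/-- Lowering operator on vectors. -/
def low {d : ℕ} (α : Fin d) (v : Ix d → ℂ) : Ix d → ℂ :=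
  fun K => if α ∈ K then 0 else sg K α * v (insert α K)

lemma pair_low {d : ℕ} (v : Ix d → ℂ) (f : Gr d) (α : Fin d) (L : Ix d) :
    pair v (opX α f) L = (-1 : ℂ) ^ L.card * pair (low α v) f L := by
  rw [pair_apply, pair_apply, Finset.mul_sum]
  simp only [opX_apply, low, mul_ite, ite_mul, mul_zero, zero_mul]
  rw [← Finset.sum_filter]
  have : ∀ g : Ix d → ℂ, (∑ K, if α ∈ K then 0 else g K) = ∑ K ∈ Finset.univ.filter (fun K : Ix d => α ∉ K), g K := by
    intro g
    rw [Finset.sum_filter]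
    refine Finset.sum_congr rfl fun K _ => ?_
    split_ifs <;> simp_all
  rw [this]
  refine Finset.sum_bij' (fun K _ => K.erase α) (fun K _ => insert α K) ?_ ?_ ?_ ?_ ?_
  · intro K hK; simp
  · intro K hK; simp
  · intro K hK
    exact Finset.insert_erase (by simpa using hK)
  · intro K hK
    exact Finset.erase_insert (by simpa using hK)
  · intro K hK
    have hK : α ∈ K := by simpa using hK
    simp only [Finset.insert_erase hK, sg_erase _ _ _ hK, lt_irrefl, if_false]
    ring

lemma pair_low_zero {d : ℕ} (hd : 1 ≤ d) (a b c : Matrix (Fin d) (Fin d) ℂ) (hb : IsUnit b)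
    (v : Ix d → ℂ) (h : pair v (gexp (quadZ a b c)) = 0) (α : Fin d) :
    pair (low α v) (gexp (quadZ a b c)) = 0 := by
  have key (β : Fin d) : ∑ γ, b γ β • pair v (opX γ (gexp (quadZ a b c))) = 0 := by
    have h1 := congrArg (pair v) (D_exp hd a b c β)
    rw [pair_D _ _ _ h] at h1
    simp only [opS, LinearMap.add_apply, LinearMap.smul_apply, LinearMap.sum_apply, map_add, map_smul, map_sum, pair_Y _ _ _ h, smul_zero, Finset.sum_const_zero, add_zero] at h1
    exact h1.symm
  have hz : ∀ L, pair v (opX α (gexp (quadZ a b c))) L = 0 := by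
    intro L
    have h2 : Matrix.vecMul (fun γ => pair v (opX γ (gexp (quadZ a b c))) L) b = 0 := by
      funext β
      have := congrFun (key β) L
      simp only [Finset.sum_apply, Pi.smul_apply, smul_eq_mul, Pi.zero_apply] at this
      rw [Matrix.vecMul, dotProduct, Pi.zero_apply, ← this]
      exact Finset.sum_congr rfl fun I _ => by ring
    have h3 : (fun γ => pair v (opX γ (gexp (quadZ a b c))) L) = 0 :=
      Matrix.vecMul_injective_of_isUnit hb (by simpa using h2)
    exact congrFun h3 α
  funext L
  have := hz L
  rw [pair_low] at this
  simpa using this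

lemma kernel_zero {d : ℕ} (hd : 1 ≤ d) (a b c : Matrix (Fin d) (Fin d) ℂ) (hb : IsUnit b) (n : ℕ) :
    ∀ v : Ix d → ℂ, pair v (gexp (quadZ a b c)) = 0 → (∀ K : Ix d, n < K.card → v K = 0) → v = 0 := by
  have base : ∀ v : Ix d → ℂ, pair v (gexp (quadZ a b c)) = 0 → (∀ K : Ix d, 0 < K.card → v K = 0) → v = 0 := by
    intro v hv hK
    funext K
    rcases Finset.eq_empty_or_nonempty K with rfl | h
    · have := congrFun hv ∅
      rw [pair_apply, Finset.sum_eq_single ∅, exp_zero, mul_one] at this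
      · exact this
      · intro K _ hne
        rw [hK K (Finset.card_pos.2 (Finset.nonempty_iff_ne_empty.2 hne)), zero_mul]
      · simp
    · exact hK K (Finset.card_pos.2 h)
  induction n with
  | zero => exact base
  | succ n ih =>
    intro v hv hK
    refine base v hv fun K hpos => ?_
    obtain ⟨α, hα⟩ := Finset.card_pos.1 hpos
    have h1 := ih (low α v) (pair_low_zero hd a b c hb v hv α) (by
      intro M hM
      unfold low
      split_ifs with h
      · rfl
      · rw [hK _ (by rw [Finset.card_insert_of_notMem h]; omega), mul_zero])
    have h2 := congrFun h1 (K.erase α)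
    simp only [low, Finset.mem_erase, ne_eq, not_true_eq_false, false_and, if_false, Finset.insert_erase hα, Pi.zero_apply] at h2
    exact (mul_eq_zero.1 h2).resolve_left (sg_ne _ _)

/-- Let `d ≥ 1` and let `a, b, c` be `d×d` complex matrices with `b`
invertible. Set `Z = (1/2)a_{αγ}θ^αθ^γ + b_{αβ}θ^αθ̄^β + (1/2)c_{βδ}θ̄^βθ̄^δ ∈ Λ_d` and
write `e^Z = w_{IJ} θ^I θ̄^J` (in the coefficient representation, `w I J = gexp Z I J`).
Then the `2^d × 2^d` matrix `(w_{IJ})`, rows indexed by `I ⊆ [d]` and columns by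
`J ⊆ [d]`, is invertible. -/
theorem statement0 {d : ℕ} (hd : 1 ≤ d) (a b c : Matrix (Fin d) (Fin d) ℂ)
    (hb : IsUnit b)
    (w : Ix d → Ix d → ℂ) (hw : ∀ I J, w I J = gexp (quadZ a b c) I J) :
    IsUnit (Matrix.of fun I J : Ix d => w I J) := by
  rw [← Matrix.vecMul_injective_iff_isUnit]
  rw [← Matrix.coe_vecMulLinear, injective_iff_map_eq_zero]
  intro v hv
  refine kernel_zero hd a b c hb d v ?_ ?_
  · funext L
    have := congrFun hv L
    simp only [Matrix.vecMulLinear_apply, Matrix.vecMul, dotProduct, Matrix.of_apply, hw] at this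
    exact this
  · intro K hK
    have := Finset.card_le_univ K
    simp at this
    omega

end Grass
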